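/- arXiv:1811.11332 — 6 statements merged into one kernel-verified Lean document; each statement's English description precedes it below -/
import Mathlib

section
/- For all real λ_l > 0, λ_c > 0 and t > 0, let q(t) = (1/t)·∫_0^t exp(−2·λ_c·(t−y)) dy. Then ( exp(−2·λ_c·t) · Σ_{n=0}^∞ [exp(−2·λ_l·t)·(2·λ_l·t)^n / n!] · q(t)^n )^2 = exp( −4·λ_c·t − 4·λ_l·t + (2·λ_l/λ_c)·(1 − exp(−2·λ_c·t)) ). (This identity is the computation of the void probability P(T_m > t) in Theorem 1: the left-hand side is the product, over the two axes, of the void probability on the conditioning line times the Poisson mixture over lines crossing the square exclusion zone, and the right-hand side is the complement 1 − F_{T_m}(t) of the CDF of the shortest path distance from the typical intersection of the Manhattan Poisson line process to the nearest point of the Manhattan Poisson line Cox process.) -/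
open Real MeasureTheory

/-- Theorem 1 void-probability identity for the typical intersection of the MPLP. -/
theorem mplcp_typical_intersection_void_probability
    (lamL lamC t : ℝ) (hL : 0 < lamL) (hC : 0 < lamC) (ht : 0 < t) :
    (Real.exp (-2 * lamC * t) *
        ∑' n : ℕ, (Real.exp (-2 * lamL * t) * (2 * lamL * t) ^ n / (n.factorial : ℝ)) *
          ((1 / t) * ∫ y in (0:ℝ)..t, Real.exp (-2 * lamC * (t - y))) ^ n) ^ 2
      = Real.exp (-4 * lamC * t - 4 * lamL * t +
          (2 * lamL / lamC) * (1 - Real.exp (-2 * lamC * t))) := by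
  have hI : ∫ y in (0:ℝ)..t, Real.exp (-2 * lamC * (t - y))
      = (1 - Real.exp (-2 * lamC * t)) / (2 * lamC) := by
    have hd : ∀ y ∈ Set.uIcc (0:ℝ) t,
        HasDerivAt (fun y => Real.exp (-2 * lamC * (t - y)) / (2 * lamC))
          (Real.exp (-2 * lamC * (t - y))) y := by
      intro y _
      have h1 : HasDerivAt (fun y : ℝ => -2 * lamC * (t - y)) (-2 * lamC * (-1)) y :=
        ((hasDerivAt_id y).const_sub t).const_mul (-2 * lamC)
      have h2 := h1.exp.div_const (2 * lamC)
      have h3 : Real.exp (-2 * lamC * (t - y)) * (-2 * lamC * (-1)) / (2 * lamC)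
          = Real.exp (-2 * lamC * (t - y)) := by
        rw [div_eq_iff (by positivity)]
        ring
      rw [h3] at h2
      exact h2
    rw [intervalIntegral.integral_eq_sub_of_hasDerivAt hd
      (Continuous.intervalIntegrable (by fun_prop) _ _)]
    simp only [sub_self, mul_zero, Real.exp_zero, sub_zero]
    ring
  rw [hI]
  set q : ℝ := (1 / t) * ((1 - Real.exp (-2 * lamC * t)) / (2 * lamC)) with hq
  have hS : ∑' n : ℕ, (Real.exp (-2 * lamL * t) * (2 * lamL * t) ^ n / (n.factorial : ℝ)) * q ^ n
      = Real.exp (-2 * lamL * t) * Real.exp (2 * lamL * t * q) := by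
    have he : Real.exp (2 * lamL * t * q)
        = ∑' n : ℕ, (2 * lamL * t * q) ^ n / (n.factorial : ℝ) := by
      rw [Real.exp_eq_exp_ℝ, NormedSpace.exp_eq_tsum_div (𝔸 := ℝ)]
    rw [he, ← tsum_mul_left]
    refine tsum_congr fun n => ?_
    rw [mul_pow (2 * lamL * t) q n]
    ring
  rw [hS, ← Real.exp_add, ← Real.exp_add, ← Real.exp_nat_mul]
  congr 1
  rw [hq]
  push_cast
  field_simp
  ring
end

section
/- For all real λ_l > 0 and λ_c > 0, the function F_int : [0, ∞) → ℝ defined by F_int(t) = 1 − exp( −4·λ_c·t − 4·λ_l·t + (2·λ_l/λ_c)·(1 − exp(−2·λ_c·t)) ) is a valid cumulative distribution function on [0, ∞): F_int(0) = 0, F_int is monotonically nondecreasing on [0, ∞), 0 ≤ F_int(t) ≤ 1 for all t ≥ 0, and F_int(t) → 1 as t → ∞. -/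
open Real Filter

theorem mplcp_aux (lamL lamC : ℝ) (hL : 0 < lamL) (hC : 0 < lamC) (s t : ℝ) (hs : 0 ≤ s)
    (hst : s ≤ t) :
    (-4 * lamC * t - 4 * lamL * t + (2 * lamL / lamC) * (1 - Real.exp (-2 * lamC * t))) ≤
    (-4 * lamC * s - 4 * lamL * s + (2 * lamL / lamC) * (1 - Real.exp (-2 * lamC * s)))
      - 4 * lamC * (t - s) := by
  have h1 : Real.exp (-2 * lamC * t)
      = Real.exp (-2 * lamC * s) * Real.exp (-2 * lamC * (t - s)) := by
    rw [← Real.exp_add]; ring_nf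
  have h2 := Real.add_one_le_exp (-2 * lamC * (t - s))
  have h3 : Real.exp (-2 * lamC * s) ≤ 1 := by
    apply Real.exp_le_one_iff.2
    nlinarith [mul_nonneg hC.le hs]
  have h4 := Real.exp_pos (-2 * lamC * s)
  have h5 : 0 ≤ lamC * (t - s) := mul_nonneg hC.le (by linarith)
  have h6 : Real.exp (-2 * lamC * s) - Real.exp (-2 * lamC * t) ≤ 2 * lamC * (t - s) := by
    rw [h1]
    nlinarith [mul_le_mul_of_nonneg_left h2 h4.le, mul_le_mul_of_nonneg_right h3 h5]
  have h7 := mul_le_mul_of_nonneg_left h6 (by positivity : 0 ≤ 2 * lamL / lamC)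
  have h8 : 2 * lamL / lamC * (2 * lamC * (t - s)) = 4 * lamL * (t - s) := by
    field_simp; ring
  rw [h8] at h7
  linarith

/-- The CDF of Theorem 1 is a valid CDF on `[0, ∞)`. -/
theorem mplcp_typical_intersection_cdf_is_valid
    (lamL lamC : ℝ) (hL : 0 < lamL) (hC : 0 < lamC) :
    let F : ℝ → ℝ := fun t =>
      1 - Real.exp (-4 * lamC * t - 4 * lamL * t +
        (2 * lamL / lamC) * (1 - Real.exp (-2 * lamC * t)))
    F 0 = 0 ∧ MonotoneOn F (Set.Ici (0:ℝ)) ∧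
      (∀ t : ℝ, 0 ≤ t → 0 ≤ F t ∧ F t ≤ 1) ∧
      Tendsto F atTop (nhds 1) := by
  intro F
  have h0 : F 0 = 0 := by simp [F]
  have hm : MonotoneOn F (Set.Ici (0:ℝ)) := by
    intro s hs t _ hst
    have h := mplcp_aux lamL lamC hL hC s t hs hst
    have h5 : 0 ≤ lamC * (t - s) := mul_nonneg hC.le (by linarith)
    apply sub_le_sub_left
    apply Real.exp_le_exp.2
    linarith
  refine ⟨h0, hm, ?_, ?_⟩
  · intro t ht
    refine ⟨?_, sub_le_self _ (Real.exp_pos _).le⟩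
    rw [← h0]
    exact hm (Set.mem_Ici.2 le_rfl) ht ht
  · have hb : Tendsto (fun t : ℝ => -(4 * lamC * t)) atTop atBot :=
      tendsto_neg_atTop_atBot.comp (tendsto_id.const_mul_atTop (by positivity))
    have hg : Tendsto (fun t : ℝ => -4 * lamC * t - 4 * lamL * t +
        (2 * lamL / lamC) * (1 - Real.exp (-2 * lamC * t))) atTop atBot := by
      refine tendsto_atBot_mono' _ ?_ hb
      filter_upwards [eventually_ge_atTop 0] with t ht
      have h := mplcp_aux lamL lamC hL hC 0 t le_rfl ht
      simp only [mul_zero, Real.exp_zero, sub_self, sub_zero, add_zero] at h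
      linarith
    have := (Real.tendsto_exp_atBot.comp hg).const_sub 1
    simpa [F, Function.comp_def] using this
end

section
/- For all real λ_l > 0, λ_c > 0 and w > 0, let q(w) = (1/w)·∫_0^w exp(−2·λ_c·(w−y)) dy. Then exp(−λ_c·w) · exp(−2·λ_c·w) · ( Σ_{n=0}^∞ [exp(−2·λ_l·w)·(2·λ_l·w)^n / n!] · q(w)^n ) · ( Σ_{n=0}^∞ [exp(−λ_l·w)·(λ_l·w)^n / n!] · q(w)^n ) = exp( −3·λ_c·w − 3·λ_l·w + (3·λ_l/(2·λ_c))·(1 − exp(−2·λ_c·w)) ). (This is the void probability computation in Lemma 2 for the case w ≤ x_2, where the exclusion zone is a square: the left-hand side collects the void probability on the conditioning horizontal line, on the vertical line of the intersection, the Poisson mixture over crossing horizontal lines with mean 2·λ_l·w, and the Poisson mixture over crossing vertical lines with mean λ_l·w; the right-hand side equals 1 − F_{W_1,1}(w).) -/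
open Real MeasureTheory

theorem mplcp_aux_sum (a m q : ℝ) :
    (∑' n : ℕ, (Real.exp a * m ^ n / (n.factorial : ℝ)) * q ^ n) = Real.exp (a + m * q) := by
  have h : ∀ n : ℕ, (Real.exp a * m ^ n / (n.factorial : ℝ)) * q ^ n
      = Real.exp a * ((m * q) ^ n / (n.factorial : ℝ)) := by
    intro n
    rw [mul_pow]
    ring
  simp_rw [h]
  rw [tsum_mul_left, Real.exp_add, Real.exp_eq_exp_ℝ, NormedSpace.exp_eq_tsum_div]

theorem mplcp_aux_int (c w : ℝ) (hc : 0 < c) :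
    (∫ y in (0:ℝ)..w, Real.exp (-2 * c * (w - y))) = (1 - Real.exp (-2 * c * w)) / (2 * c) := by
  have hd : ∀ y ∈ Set.uIcc 0 w, HasDerivAt (fun y : ℝ => Real.exp (-2 * c * (w - y)) / (2 * c))
      (Real.exp (-2 * c * (w - y))) y := by
    intro y _
    have h1 : HasDerivAt (fun y : ℝ => -2 * c * (w - y)) (-2 * c * (-1)) y :=
      ((hasDerivAt_id y).const_sub w).const_mul (-2 * c)
    refine (h1.exp.div_const (2 * c)).congr_deriv ?_
    rw [div_eq_iff (by positivity)]
    ring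
  rw [intervalIntegral.integral_eq_sub_of_hasDerivAt hd
    (Continuous.intervalIntegrable (by fun_prop) _ _)]
  simp
  ring

/-- Lemma 2 void-probability identity in the case `w ≤ x₂` (square exclusion zone). -/
theorem mplcp_lemma2_square_void_probability
    (lamL lamC w : ℝ) (hL : 0 < lamL) (hC : 0 < lamC) (hw : 0 < w) :
    Real.exp (-lamC * w) * Real.exp (-2 * lamC * w) *
        (∑' n : ℕ, (Real.exp (-2 * lamL * w) * (2 * lamL * w) ^ n / (n.factorial : ℝ)) *
          ((1 / w) * ∫ y in (0:ℝ)..w, Real.exp (-2 * lamC * (w - y))) ^ n) *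
        (∑' n : ℕ, (Real.exp (-lamL * w) * (lamL * w) ^ n / (n.factorial : ℝ)) *
          ((1 / w) * ∫ y in (0:ℝ)..w, Real.exp (-2 * lamC * (w - y))) ^ n)
      = Real.exp (-3 * lamC * w - 3 * lamL * w +
          (3 * lamL / (2 * lamC)) * (1 - Real.exp (-2 * lamC * w))) := by
  rw [mplcp_aux_sum, mplcp_aux_sum, mplcp_aux_int lamC w hC, ← Real.exp_add, ← Real.exp_add,
    ← Real.exp_add]
  congr 1
  field_simp
  ring
end

section
/- For all real λ_l > 0, λ_c > 0 and 0 < x_2 < w, define q_1 = (1/(w−x_2))·∫_0^{w−x_2} exp(−λ_c·(x_2 + w − y)) dy, q_2 = (1/x_2)·∫_{w−x_2}^{w} exp(−2·λ_c·(w−y)) dy, and q_3 = (1/w)·∫_0^{w} exp(−2·λ_c·(w−x)) dx. Then exp(−λ_c·w) · exp(−2·λ_c·w) · ( Σ_{n=0}^∞ [exp(−2·λ_l·(w−x_2))·(2·λ_l·(w−x_2))^n / n!] · q_1^n ) · ( Σ_{n=0}^∞ [exp(−λ_l·x_2)·(λ_l·x_2)^n / n!] · q_2^n )^2 · ( Σ_{n=0}^∞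 [exp(−λ_l·w)·(λ_l·w)^n / n!] · q_3^n ) = exp( −3·(λ_c + λ_l)·w + (λ_l/(2·λ_c))·( 3 + 2·exp(−2·λ_c·x_2) − exp(−2·λ_c·w) − 4·exp(−λ_c·(x_2 + w)) ) ). (This is the void probability computation in Lemma 2 for the case w > x_2, where the exclusion zone is a pentagon; the right-hand side equals 1 − F_{W_1,2}(w | x_2).) -/
open Real MeasureTheory

theorem mix_aux (m E q : ℝ) :
    (∑' n : ℕ, (E * m ^ n / (n.factorial : ℝ)) * q ^ n) = E * Real.exp (m * q) := by
  rw [Real.exp_eq_exp_ℝ, NormedSpace.exp_eq_tsum_div, ← tsum_mul_left]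
  refine tsum_congr fun n => ?_
  rw [mul_pow]
  ring

theorem int_aux (k c a b : ℝ) (hk : k ≠ 0) :
    (∫ y in a..b, Real.exp (-k * (c - y)))
      = (Real.exp (-k * (c - b)) - Real.exp (-k * (c - a))) / k := by
  have hd : ∀ y ∈ Set.uIcc a b,
      HasDerivAt (fun y : ℝ => Real.exp (-k * (c - y)) / k) (Real.exp (-k * (c - y))) y := by
    intro y _
    have h := ((((hasDerivAt_id y).const_sub c).const_mul (-k)).exp).div_const k
    refine h.congr_deriv ?_
    simp only [id]
    field_simp
  rw [intervalIntegral.integral_eq_sub_of_hasDerivAt hd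
    ((by fun_prop : Continuous fun y : ℝ => Real.exp (-k * (c - y))).intervalIntegrable a b)]
  ring

/-- Lemma 2 void-probability identity in the case `w > x₂` (pentagonal exclusion zone). -/
theorem mplcp_lemma2_pentagon_void_probability
    (lamL lamC x2 w : ℝ) (hL : 0 < lamL) (hC : 0 < lamC) (hx2 : 0 < x2) (hx2w : x2 < w) :
    Real.exp (-lamC * w) * Real.exp (-2 * lamC * w) *
        (∑' n : ℕ, (Real.exp (-2 * lamL * (w - x2)) * (2 * lamL * (w - x2)) ^ n /
            (n.factorial : ℝ)) *
          ((1 / (w - x2)) * ∫ y in (0:ℝ)..(w - x2), Real.exp (-lamC * (x2 + w - y))) ^ n) *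
        (∑' n : ℕ, (Real.exp (-lamL * x2) * (lamL * x2) ^ n / (n.factorial : ℝ)) *
          ((1 / x2) * ∫ y in (w - x2)..w, Real.exp (-2 * lamC * (w - y))) ^ n) ^ 2 *
        (∑' n : ℕ, (Real.exp (-lamL * w) * (lamL * w) ^ n / (n.factorial : ℝ)) *
          ((1 / w) * ∫ x in (0:ℝ)..w, Real.exp (-2 * lamC * (w - x))) ^ n)
      = Real.exp (-3 * (lamC + lamL) * w +
          (lamL / (2 * lamC)) * (3 + 2 * Real.exp (-2 * lamC * x2) - Real.exp (-2 * lamC * w)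
            - 4 * Real.exp (-lamC * (x2 + w)))) := by
  have h2 : (2 * lamC) ≠ 0 := by positivity
  have hw : w ≠ 0 := by linarith
  have hx : x2 ≠ 0 := hx2.ne'
  have hd : w - x2 ≠ 0 := by linarith
  have hc : lamC ≠ 0 := hC.ne'
  have e2 : -2 * lamC = -(2 * lamC) := by ring
  rw [mix_aux, mix_aux, mix_aux, int_aux lamC _ _ _ hc, e2, int_aux _ _ _ _ h2, int_aux _ _ _ _ h2]
  have a1 : -lamC * (x2 + w - (w - x2)) = -(2 * lamC) * x2 := by ring
  have a2 : w - (w - x2) = x2 := by ring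
  rw [a1, a2, sub_zero, sub_zero, sub_self, mul_zero, Real.exp_zero, ← Real.exp_add, ← Real.exp_add,
    ← Real.exp_add, ← Real.exp_add, ← Real.exp_nat_mul, ← Real.exp_add, ← Real.exp_add,
    ← Real.exp_add]
  congr 1
  generalize Real.exp (-(2 * lamC) * x2) = A
  generalize Real.exp (-(2 * lamC) * w) = B
  generalize Real.exp (-lamC * (x2 + w)) = C
  push_cast
  field_simp
  ring
end

section
/- Fix real λ_l > 0, λ_c > 0 and x ≥ 0, and define G(w) for w ≥ 0 by G(w) = exp(−3·λ_c·w − 3·λ_l·w + (3·λ_l/(2·λ_c))·(1 − exp(−2·λ_c·w))) if 0 ≤ w ≤ x, and G(w) = exp(−3·(λ_c+λ_l)·w + (λ_l/(2·λ_c))·(3 + 2·exp(−2·λ_c·x) − exp(−2·λ_c·w) − 4·exp(−λ_c·(x+w)))) if w > x. Then F(w) := 1 − G(w) is a valid cumulative distribution function on [0, ∞): F(0) = 0, F is monotonically nondecreasing on [0, ∞), 0 ≤ F(w) ≤ 1 for all w ≥ 0, and F(w) → 1 as w → ∞. -/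
open Real Filter

lemma exp_neg_diff_le (s t : ℝ) (hs : 0 ≤ s) (hst : s ≤ t) :
    Real.exp (-s) - Real.exp (-t) ≤ t - s := by
  have h1 : Real.exp (-t) = Real.exp (-s) * Real.exp (-(t - s)) := by
    rw [← Real.exp_add]; congr 1; ring
  have h2 := Real.add_one_le_exp (-(t - s))
  have h3 : Real.exp (-s) ≤ 1 := Real.exp_le_one_iff.mpr (by linarith)
  have h4 := Real.exp_pos (-s)
  rw [h1]
  nlinarith [mul_nonneg h4.le (sub_nonneg.mpr h2), mul_nonneg (sub_nonneg.mpr h3) (sub_nonneg.mpr hst)]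

/-- The piecewise conditional CDF `F_{W₁}(· | E₃, x₁, x₂)` of Lemma 2 is a valid CDF
on `[0, ∞)`. -/
theorem mplcp_lemma2_piecewise_cdf_is_valid
    (lamL lamC x : ℝ) (hL : 0 < lamL) (hC : 0 < lamC) (hx : 0 ≤ x) :
    let G : ℝ → ℝ := fun w =>
      if w ≤ x then
        Real.exp (-3 * lamC * w - 3 * lamL * w +
          (3 * lamL / (2 * lamC)) * (1 - Real.exp (-2 * lamC * w)))
      else
        Real.exp (-3 * (lamC + lamL) * w +
          (lamL / (2 * lamC)) * (3 + 2 * Real.exp (-2 * lamC * x) - Real.exp (-2 * lamC * w)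
            - 4 * Real.exp (-lamC * (x + w))))
    let F : ℝ → ℝ := fun w => 1 - G w
    F 0 = 0 ∧ MonotoneOn F (Set.Ici (0:ℝ)) ∧
      (∀ w : ℝ, 0 ≤ w → 0 ≤ F w ∧ F w ≤ 1) ∧
      Tendsto F atTop (nhds 1) := by
  intro G F
  have hk : 0 < lamL / (2 * lamC) := by positivity
  have hkc : lamL / (2 * lamC) * (2 * lamC) = lamL := by field_simp
  have h3k : 3 * lamL / (2 * lamC) = 3 * (lamL / (2 * lamC)) := by ring
  set k := lamL / (2 * lamC) with hkdef
  let A : ℝ → ℝ := fun w => -3 * lamC * w - 3 * lamL * w +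
          (3 * lamL / (2 * lamC)) * (1 - Real.exp (-2 * lamC * w))
  let B : ℝ → ℝ := fun w => -3 * (lamC + lamL) * w +
          k * (3 + 2 * Real.exp (-2 * lamC * x) - Real.exp (-2 * lamC * w)
            - 4 * Real.exp (-lamC * (x + w)))
  have hGA : ∀ w, w ≤ x → G w = Real.exp (A w) := fun w hw => if_pos hw
  have hGB : ∀ w, ¬ w ≤ x → G w = Real.exp (B w) := fun w hw => if_neg hw
  have hD : ∀ a b, 0 ≤ a → a ≤ b →
      Real.exp (-2 * lamC * a) - Real.exp (-2 * lamC * b) ≤ 2 * lamC * (b - a) := by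
    intro a b ha hab
    have := exp_neg_diff_le (2 * lamC * a) (2 * lamC * b) (by positivity) (by gcongr)
    rw [show -2 * lamC * a = -(2 * lamC * a) by ring,
      show -2 * lamC * b = -(2 * lamC * b) by ring]
    linarith
  have hE : ∀ a b, 0 ≤ a → a ≤ b →
      Real.exp (-lamC * (x + a)) - Real.exp (-lamC * (x + b)) ≤ lamC * (b - a) := by
    intro a b ha hab
    have := exp_neg_diff_le (lamC * (x + a)) (lamC * (x + b)) (by positivity) (by gcongr)
    rw [show -lamC * (x + a) = -(lamC * (x + a)) by ring,
      show -lamC * (x + b) = -(lamC * (x + b)) by ring]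
    linarith
  have hA : ∀ a b, 0 ≤ a → a ≤ b → A b ≤ A a := by
    intro a b ha hab
    have h1 := mul_le_mul_of_nonneg_left (hD a b ha hab) hk.le
    rw [← mul_assoc, hkc] at h1
    have h2 := mul_nonneg hC.le (sub_nonneg.mpr hab)
    simp only [A, h3k]
    linarith
  have hB : ∀ a b, 0 ≤ a → a ≤ b → B b ≤ B a := by
    intro a b ha hab
    have h1 := mul_le_mul_of_nonneg_left (hD a b ha hab) hk.le
    have h3 := mul_le_mul_of_nonneg_left (hE a b ha hab) hk.le
    have h4 : k * (lamC * (b - a)) = lamL * (b - a) / 2 := by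
      rw [← hkc]; ring
    rw [← mul_assoc, hkc] at h1
    rw [h4] at h3
    have h2 := mul_nonneg hC.le (sub_nonneg.mpr hab)
    simp only [B]
    linarith
  have hAB : A x = B x := by
    simp only [A, B, h3k]
    rw [show -lamC * (x + x) = -2 * lamC * x by ring]
    ring
  have hG0 : G 0 = 1 := by
    rw [hGA 0 hx]; simp [A]
  have hmono : ∀ a b, 0 ≤ a → a ≤ b → G b ≤ G a := by
    intro a b ha hab
    by_cases hb : b ≤ x
    · rw [hGA b hb, hGA a (hab.trans hb)]
      exact Real.exp_le_exp.mpr (hA a b ha hab)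
    · rw [hGB b hb]
      by_cases hax : a ≤ x
      · rw [hGA a hax]
        refine Real.exp_le_exp.mpr ?_
        have := hA a x ha hax
        have := hB x b hx (not_le.mp hb).le
        linarith
      · rw [hGB a hax]
        exact Real.exp_le_exp.mpr (hB a b ha hab)
  have hpos : ∀ w, 0 < G w := by
    intro w
    by_cases hw : w ≤ x
    · rw [hGA w hw]; exact Real.exp_pos _
    · rw [hGB w hw]; exact Real.exp_pos _
  refine ⟨?_, ?_, ?_, ?_⟩
  · simp only [F, hG0, sub_self]
  · intro a ha b _ hab
    have := hmono a b ha hab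
    simp only [F]
    linarith
  · intro w hw
    have h1 := hmono 0 w le_rfl hw
    have h2 := hpos w
    simp only [F]
    constructor <;> linarith
  · have hlim : Tendsto G atTop (nhds 0) := by
      have hb : Tendsto (fun w : ℝ => Real.exp (-3 * (lamC + lamL) * w +
          k * (3 + 2 * Real.exp (-2 * lamC * x)))) atTop (nhds 0) := by
        refine Real.tendsto_exp_atBot.comp ?_
        refine tendsto_atBot_add_const_right _ _ ?_
        exact tendsto_id.const_mul_atTop_of_neg (by linarith)
      refine tendsto_of_tendsto_of_tendsto_of_le_of_le' tendsto_const_nhds hb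
        (Eventually.of_forall fun w => (hpos w).le) ?_
      filter_upwards [eventually_gt_atTop x] with w hw
      rw [hGB w (not_le.mpr hw)]
      refine Real.exp_le_exp.mpr ?_
      have h1 := Real.exp_pos (-2 * lamC * w)
      have h2 := Real.exp_pos (-lamC * (x + w))
      simp only [B]
      gcongr
      linarith
    have := (tendsto_const_nhds (x := (1:ℝ))).sub hlim
    simpa [F] using this
end

section
/- Fix real λ_l > 0, λ_c > 0 and 0 ≤ x_1 ≤ x_2 with x_2 > 0. Let D be a random variable exponentially distributed with rate λ_c, and let Z be a nonnegative random variable, independent of D, whose survival function satisfies P(Z > w) = exp(−3·λ_c·w − 3·λ_l·w + (3·λ_l/(2·λ_c))·(1 − exp(−2·λ_c·w))) for all 0 ≤ w ≤ x_2. Then: (i) for 0 ≤ r ≤ x_1, P(min(x_1 + Z, D) ≤ r | D ≤ x_2) = (1 − exp(−λ_c·r))/(1 − exp(−λ_c·x_2)); and (ii) for x_1 ≤ r < x_2, P(min(x_1 + Z, D) ≤ r | D ≤ x_2) = 1 − exp(−3·λ_c·(r−x_1) − 3·λ_l·(r−x_1) + (3·λ_l/(2·λ_c))·(1 − exp(−2·λ_c·(r−x_1))))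 · (exp(−λ_c·r) − exp(−λ_c·x_2))/(1 − exp(−λ_c·x_2)). -/
open MeasureTheory ProbabilityTheory

lemma E4_aux {Ω : Type*} [MeasurableSpace Ω] (μ : Measure Ω) [IsProbabilityMeasure μ]
    (c x1 x2 : ℝ) (hC : 0 < c) (hx2 : 0 < x2)
    (D Z : Ω → ℝ) (hD : Measurable D) (hZ : Measurable Z)
    (hindep : IndepFun D Z μ) (hD_law : Measure.map D μ = expMeasure c)
    (r S : ℝ) (hr0 : 0 ≤ r) (hr : r ≤ x2) (hS : μ.real {ω | r - x1 < Z ω} = S) :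
    (μ[|{ω | D ω ≤ x2}]) {ω | min (x1 + Z ω) (D ω) ≤ r} = ENNReal.ofReal
      (1 - S * (Real.exp (-c * r) - Real.exp (-c * x2)) / (1 - Real.exp (-c * x2))) := by
  have hF : ∀ x, 0 ≤ x → μ.real {ω | D ω ≤ x} = 1 - Real.exp (-c * x) := by
    intro x hx
    have : IsProbabilityMeasure (expMeasure c) := isProbabilityMeasure_expMeasure hC
    have h := cdf_expMeasure_eq hC x
    rw [cdf_eq_real, ← hD_law, map_measureReal_apply hD measurableSet_Iic, if_pos hx] at h
    rw [neg_mul]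
    exact h
  have hs : MeasurableSet {ω | D ω ≤ x2} := measurableSet_le hD measurable_const
  have hr' : MeasurableSet {ω | D ω ≤ r} := measurableSet_le hD measurable_const
  have hm1 : MeasurableSet {ω | r < D ω ∧ D ω ≤ x2} := hD measurableSet_Ioc
  have hm2 : MeasurableSet {ω | r - x1 < Z ω} := hZ measurableSet_Ioi
  have h1 : μ.real {ω | r < D ω ∧ D ω ≤ x2} = Real.exp (-c * r) - Real.exp (-c * x2) := by
    have : {ω | r < D ω ∧ D ω ≤ x2} = {ω | D ω ≤ x2} \ {ω | D ω ≤ r} := by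
      ext ω; simp [and_comm]
    have hsub : {ω | D ω ≤ r} ⊆ {ω | D ω ≤ x2} := fun ω h => le_trans h hr
    rw [this, measureReal_sdiff hsub hr', hF _ hx2.le, hF _ hr0]
    ring
  have h2 : μ.real ({ω | r < D ω ∧ D ω ≤ x2} ∩ {ω | r - x1 < Z ω})
      = (Real.exp (-c * r) - Real.exp (-c * x2)) * S := by
    rw [← h1, ← hS]
    have := hindep.measure_inter_preimage_eq_mul (Set.Ioc r x2) (Set.Ioi (r - x1))
      measurableSet_Ioc measurableSet_Ioi
    simp only [Measure.real, ← ENNReal.toReal_mul]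
    exact congrArg ENNReal.toReal this
  have h3 : {ω | D ω ≤ x2} ∩ {ω | min (x1 + Z ω) (D ω) ≤ r}
      = {ω | D ω ≤ x2} \ ({ω | r < D ω ∧ D ω ≤ x2} ∩ {ω | r - x1 < Z ω}) := by
    ext ω
    simp only [Set.mem_inter_iff, Set.mem_ofPred_eq, Set.mem_sdiff, min_le_iff]
    grind
  have hpos : 0 < 1 - Real.exp (-c * x2) := by
    have : Real.exp (-c * x2) < 1 := Real.exp_lt_one_iff.2 (by nlinarith)
    linarith
  have h4 : (μ[|{ω | D ω ≤ x2}]).real {ω | min (x1 + Z ω) (D ω) ≤ r} =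
      1 - S * (Real.exp (-c * r) - Real.exp (-c * x2)) / (1 - Real.exp (-c * x2)) := by
    have hsub : {ω | r < D ω ∧ D ω ≤ x2} ∩ {ω | r - x1 < Z ω} ⊆ {ω | D ω ≤ x2} :=
      fun ω h => h.1.2
    have e : (μ[|{ω | D ω ≤ x2}]).real {ω | min (x1 + Z ω) (D ω) ≤ r} =
        (μ.real {ω | D ω ≤ x2})⁻¹ *
          μ.real ({ω | D ω ≤ x2} ∩ {ω | min (x1 + Z ω) (D ω) ≤ r}) := by
      simp only [Measure.real, cond_apply hs, ENNReal.toReal_mul, ENNReal.toReal_inv]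
    rw [e, h3, measureReal_sdiff hsub (hm1.inter hm2), h2, hF _ hx2.le]
    generalize Real.exp (-c * x2) = a at *
    generalize Real.exp (-c * r) = b at *
    have := hpos.ne'
    field_simp
  rw [← h4, ofReal_measureReal]

/-- Equation (34): conditional CDF of `min(x₁ + Z₁, D₂)` given `D₂ ≤ x₂`, where `D₂` is
exponential with rate `λ_c` and `Z₁` has the survival function `F̄_{Z₁,1}` of Lemma 2. -/
theorem mplcp_event_E4_conditional_cdf
    {Ω : Type*} [MeasureSpace Ω] [IsProbabilityMeasure (ℙ : Measure Ω)]
    (lamL lamC x1 x2 : ℝ) (hL : 0 < lamL) (hC : 0 < lamC)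
    (hx1 : 0 ≤ x1) (hx12 : x1 ≤ x2) (hx2 : 0 < x2)
    (D Z : Ω → ℝ) (hD : Measurable D) (hZ : Measurable Z)
    (hindep : IndepFun D Z ℙ)
    (hD_law : Measure.map D ℙ = expMeasure lamC)
    (hZ_nonneg : ∀ ω, 0 ≤ Z ω)
    (hZ_surv : ∀ w : ℝ, 0 ≤ w → w ≤ x2 →
      ℙ {ω | w < Z ω} = ENNReal.ofReal
        (Real.exp (-3 * lamC * w - 3 * lamL * w +
          (3 * lamL / (2 * lamC)) * (1 - Real.exp (-2 * lamC * w))))) :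
    (∀ r : ℝ, 0 ≤ r → r ≤ x1 →
      (ℙ[|{ω | D ω ≤ x2}]) {ω | min (x1 + Z ω) (D ω) ≤ r}
        = ENNReal.ofReal
            ((1 - Real.exp (-lamC * r)) / (1 - Real.exp (-lamC * x2)))) ∧
    (∀ r : ℝ, x1 ≤ r → r < x2 →
      (ℙ[|{ω | D ω ≤ x2}]) {ω | min (x1 + Z ω) (D ω) ≤ r}
        = ENNReal.ofReal
            (1 - Real.exp (-3 * lamC * (r - x1) - 3 * lamL * (r - x1) +
                (3 * lamL / (2 * lamC)) * (1 - Real.exp (-2 * lamC * (r - x1)))) *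
              (Real.exp (-lamC * r) - Real.exp (-lamC * x2)) /
                (1 - Real.exp (-lamC * x2)))) := by
  refine ⟨fun r h0 h1 => ?_, fun r h1 h2 => ?_⟩
  · have hZ0 : ℙ {ω | 0 < Z ω} = 1 := by
      rw [hZ_surv 0 le_rfl hx2.le]; simp
    have hZ1 : ℙ {ω | r - x1 < Z ω} = 1 :=
      le_antisymm prob_le_one (hZ0 ▸ measure_mono
        (fun ω (h : 0 < Z ω) => show r - x1 < Z ω by linarith))
    rw [E4_aux ℙ lamC x1 x2 hC hx2 D Z hD hZ hindep hD_law r 1 h0 (h1.trans hx12)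
      (by simp [Measure.real, hZ1])]
    have hpos : 1 - Real.exp (-lamC * x2) ≠ 0 := by
      have : Real.exp (-lamC * x2) < 1 := Real.exp_lt_one_iff.2 (by nlinarith)
      linarith
    congr 1
    generalize Real.exp (-lamC * x2) = a at *
    generalize Real.exp (-lamC * r) = b at *
    field_simp
    ring
  · refine E4_aux ℙ lamC x1 x2 hC hx2 D Z hD hZ hindep hD_law r _ (hx1.trans h1) h2.le ?_
    rw [Measure.real, hZ_surv _ (by linarith) (by linarith), ENNReal.toReal_ofReal]
    positivity
end
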